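/- Let d, n ∈ ℕ be such that 2 ≤ d ≤ 2n. Every tree-like QU-resolution falsity proof of the separation formula Φₙ from the axiom set H(Φₙ, Π_d) has a tree G(π) with at least 2^{n−⌈d/2⌉} leaves, and hence has size at least 2^{n−⌈d/2⌉}. -/

import Mathlib

/-! Framework for quantified Boolean circuits (QBCs), QU-resolution,
relaxations, and the prover–delayer game, following Chen,
"Proof Complexity Modulo the Polynomial Hierarchy". -/

/-- Quantifiers. -/
inductive Quant where
  | all : Quant
  | ex : Quant
deriving DecidableEq

/-- A partial assignment of Boolean values to (numbered) propositional
variables.  Via the correspondence `C ↔ assign(C)`, partial assignments also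
represent clauses (the clause `clause(a)` is the unique clause with variable
set `dom a` falsified by `a`); we freely identify the two. -/
abbrev PA : Type := ℕ → Option Bool

/-- The everywhere-undefined partial assignment (= the empty clause). -/
def emptyPA : PA := fun _ => none

/-- `g` extends the partial assignment `f`. -/
def ExtendsPA (g f : PA) : Prop := ∀ v b, f v = some b → g v = some b

/-- A total assignment `g` extends a partial assignment `f`; when `f`
represents a clause, this says `g` falsifies that clause. -/
def TotalExtends (g : ℕ → Bool) (f : PA) : Prop := ∀ v b, f v = some b → g v = b

/-- A partial assignment `r` satisfies a clause `C` (i.e. makes some literal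
of `C` true). -/
def SatisfiedBy (r : PA) (C : PA) : Prop := ∃ v b, C v = some b ∧ r v = some (!b)

/-- A quantified Boolean circuit: a quantifier prefix (a list of
quantifier/variable pairs) together with a Boolean function on total
assignments, represented as a predicate. -/
structure QBC where
  pfx : List (Quant × ℕ)
  matrix : (ℕ → Bool) → Prop

/-- The variables of the prefix of a QBC. -/
def QBC.vars (Φ : QBC) : List ℕ := Φ.pfx.map Prod.snd

/-- Well-formedness of a QBC: the prefix has no repeated variables, and the
matrix depends only on the values of the prefix variables. -/
def QBC.WellFormed (Φ : QBC) : Prop :=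
  Φ.vars.Nodup ∧
  ∀ f g : ℕ → Bool, (∀ v ∈ Φ.vars, f v = g v) → (Φ.matrix f ↔ Φ.matrix g)

/-- Standard semantics of a quantifier prefix over a matrix, starting from a
base assignment. -/
def evalQ : List (Quant × ℕ) → ((ℕ → Bool) → Prop) → (ℕ → Bool) → Prop
  | [], φ, g => φ g
  | (Quant.ex, v) :: P, φ, g => ∃ b, evalQ P φ (Function.update g v b)
  | (Quant.all, v) :: P, φ, g => ∀ b, evalQ P φ (Function.update g v b)

/-- Truth of a QBC. -/
def QBC.IsTrue (Φ : QBC) : Prop := ∀ g, evalQ Φ.pfx Φ.matrix g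

/-- Falsity of a QBC. -/
def QBC.IsFalse (Φ : QBC) : Prop := ¬ Φ.IsTrue

/-- The existentially quantified variables of a prefix. -/
def existVars (P : List (Quant × ℕ)) : List ℕ :=
  (P.filter fun p => decide (p.1 = Quant.ex)).map Prod.snd

/-- The universally quantified variables of a prefix. -/
def univVars (P : List (Quant × ℕ)) : List ℕ :=
  (P.filter fun p => decide (p.1 = Quant.all)).map Prod.snd

/-- The relation `u ⪯ v` of a prefix: `vᵢ ⪯ vⱼ` iff `i ≤ j`, or `j < i` and
`Qⱼ = Qⱼ₊₁ = ⋯ = Qᵢ`. -/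
def preceq (P : List (Quant × ℕ)) (u v : ℕ) : Prop :=
  ∃ i j : ℕ, (P[i]?).map Prod.snd = some u ∧ (P[j]?).map Prod.snd = some v ∧
    (i ≤ j ∨ (j < i ∧ ∀ k, j ≤ k → k ≤ i → (P[k]?).map Prod.fst = (P[j]?).map Prod.fst))

/-- `u` strictly precedes `v` (`u ⪯ v` and not `v ⪯ u`). -/
def strictPrec (P : List (Quant × ℕ)) (u v : ℕ) : Prop :=
  preceq P u v ∧ ¬ preceq P v u

/-- dom(f) ⪯ y : every variable on which `f` is defined is `⪯ y`. -/
def domPrec (P : List (Quant × ℕ)) (f : PA) (y : ℕ) : Prop :=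
  ∀ u, f u ≠ none → preceq P u y

/-- An ∃-strategy: a family of response functions for the existential
variables, each depending only on the universal variables strictly
preceding it. -/
def IsExStrategy (Φ : QBC) (σ : ℕ → (ℕ → Bool) → Bool) : Prop :=
  ∀ x ∈ existVars Φ.pfx, ∀ τ τ' : ℕ → Bool,
    (∀ y ∈ univVars Φ.pfx, strictPrec Φ.pfx y x → τ y = τ' y) → σ x τ = σ x τ'

/-- The total assignment `⟨σ, τ⟩` induced by an ∃-strategy `σ` and an
assignment `τ` to the universal variables. -/
def playE (Φ : QBC) (σ : ℕ → (ℕ → Bool) → Bool) (τ : ℕ → Bool) : ℕ → Bool :=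
  fun v => if v ∈ existVars Φ.pfx then σ v τ else τ v

/-- `σ` is a winning ∃-strategy of the prefix of `Φ` for the matrix `M`. -/
def ModelOf (Φ : QBC) (M : (ℕ → Bool) → Prop) (σ : ℕ → (ℕ → Bool) → Bool) : Prop :=
  IsExStrategy Φ σ ∧ ∀ τ : ℕ → Bool, M (playE Φ σ τ)

/-- A model of `Φ` (a winning ∃-strategy). -/
def QBC.Model (Φ : QBC) (σ : ℕ → (ℕ → Bool) → Bool) : Prop :=
  ModelOf Φ Φ.matrix σ

/-- `σ` is a model of `P : C`, where `P` is the prefix of `Φ` and `C` is a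
clause (represented by its falsifying assignment). -/
def ModelOfClause (Φ : QBC) (σ : ℕ → (ℕ → Bool) → Bool) (C : PA) : Prop :=
  ModelOf Φ (fun g => ¬ TotalExtends g C) σ

/-- `C` is an axiom of `Φ`: a clause on the variables of `Φ` such that every
model of `Φ` is a model of `P : C`. -/
def IsAxiom (Φ : QBC) (C : PA) : Prop :=
  (∀ v, C v ≠ none → v ∈ Φ.vars) ∧ ∀ σ, Φ.Model σ → ModelOfClause Φ σ C

/-- An axiom set of `Φ`. -/
def IsAxiomSet (Φ : QBC) (H : Set PA) : Prop := ∀ C ∈ H, IsAxiom Φ C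

/-- A ∀-strategy: response functions for the universal variables, each
depending only on the existential variables strictly preceding it. -/
def IsUnivStrategy (Φ : QBC) (τ : ℕ → (ℕ → Bool) → Bool) : Prop :=
  ∀ y ∈ univVars Φ.pfx, ∀ σ σ' : ℕ → Bool,
    (∀ x ∈ existVars Φ.pfx, strictPrec Φ.pfx x y → σ x = σ' x) → τ y σ = τ y σ'

/-- The total assignment `⟨τ, σ⟩` induced by a ∀-strategy `τ` and an
assignment `σ` to the existential variables. -/
def playU (Φ : QBC) (τ : ℕ → (ℕ → Bool) → Bool) (σ : ℕ → Bool) : ℕ → Bool :=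
  fun v => if v ∈ univVars Φ.pfx then τ v σ else σ v

/-- A winning ∀-strategy: every play falsifies the matrix. -/
def WinningUnivStrategy (Φ : QBC) (τ : ℕ → (ℕ → Bool) → Bool) : Prop :=
  IsUnivStrategy Φ τ ∧ ∀ σ : ℕ → Bool, ¬ Φ.matrix (playU Φ τ σ)

/-- `C` is obtainable from `D` by ∀-elimination (relative to prefix `P`):
`C = D ∖ {L}` for a literal `L` on a universal variable `y` with
`vars(C) ⪯ y`.  In assignment form: `D` is `C` additionally defined on `y`. -/
def ForallElim (P : List (Quant × ℕ)) (C D : PA) : Prop :=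
  ∃ y b, y ∈ univVars P ∧ C y = none ∧ D = Function.update C y (some b) ∧
    ∀ u, C u ≠ none → preceq P u y

/-- `γ` is the resolvent of `α` and `β` on variable `v` (in falsifying
assignment form: `α` and `β` carry complementary literals on `v`, `γ` is
the union of the remainders, which must be a clause). -/
def IsResolvent (γ α β : PA) (v : ℕ) : Prop :=
  ∃ b, α v = some b ∧ β v = some (!b) ∧ γ v = none ∧
    (∀ u, u ≠ v → γ u = (α u).elim (β u) some) ∧
    (∀ u, u ≠ v → ∀ b₁ b₂, α u = some b₁ → β u = some b₂ → b₁ = b₂)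

/-- A step in a QU-resolution proof: an axiom, a ∀-elimination (annotated with
the index of its source), or a resolution step (annotated with the indices of
its two sources and the resolved variable). -/
inductive QUStep where
  | ax (C : PA)
  | elim (C : PA) (src : ℕ)
  | res (C : PA) (src₁ src₂ : ℕ) (v : ℕ)

/-- The clause of a proof step. -/
def QUStep.clause : QUStep → PA
  | .ax C => C
  | .elim C _ => C
  | .res C _ _ _ => C

/-- The clause at position `i` of a proof. -/
def stepClause? (L : List QUStep) (i : ℕ) : Option PA := (L[i]?).map QUStep.clause

/-- Validity of the `i`-th step of a proof from axiom set `H`. -/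
def validStep (P : List (Quant × ℕ)) (H : Set PA) (L : List QUStep) (i : ℕ) : Prop :=
  match L[i]? with
  | none => True
  | some (.ax C) => C ∈ H
  | some (.elim C j) => j < i ∧ ∃ D, stepClause? L j = some D ∧ ForallElim P C D
  | some (.res C j k v) => j < i ∧ k < i ∧
      ∃ α β, stepClause? L j = some α ∧ stepClause? L k = some β ∧ IsResolvent C α β v

/-- A QU-resolution proof of `Φ` from axiom set `H`. -/
def IsQUProof (Φ : QBC) (H : Set PA) (L : List QUStep) : Prop :=
  ∀ i, validStep Φ.pfx H L i

/-- A QU-resolution falsity proof: a proof ending with the empty clause. -/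
def IsFalsityProof (Φ : QBC) (H : Set PA) (L : List QUStep) : Prop :=
  IsQUProof Φ H L ∧ (L.getLast?).map QUStep.clause = some emptyPA

/-- The clause `C` appears in the proof `L`. -/
def AppearsIn (L : List QUStep) (C : PA) : Prop := ∃ i, stepClause? L i = some C

/-- The edge relation of the graph `G(π)`: an edge from each clause occurrence
to the clause occurrence(s) from which it is derived. -/
def edge (L : List QUStep) (i j : ℕ) : Prop :=
  match L[i]? with
  | some (.elim _ s) => j = s
  | some (.res _ s t _) => j = s ∨ j = t
  | _ => False

/-- A sink (leaf) of `G(π)`: a vertex with no outgoing edges. -/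
def isSink (L : List QUStep) (i : ℕ) : Prop := i < L.length ∧ ∀ j, ¬ edge L i j

/-- The proof is tree-like: `G(π)` is a tree (each vertex has at most one
incoming edge; acyclicity holds automatically since edges decrease indices). -/
def TreeLike (L : List QUStep) : Prop := ∀ j : ℕ, {i | edge L i j}.Subsingleton

-- The prefix `P[a]`: the variables of `dom a` are removed, and the
-- quantifier of every variable strictly preceding some variable of `dom a`
-- (equivalently, every `v` with `v ⪯ last(a)` and not `last(a) ⪯ v`) is
-- changed to `∃`.
open Classical in
noncomputable def instPrefix (P : List (Quant × ℕ)) (a : PA) : List (Quant × ℕ) :=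
  (P.filter fun p => (a p.2).isNone).map fun p =>
    (if ∃ u, a u ≠ none ∧ strictPrec P p.2 u then Quant.ex else p.1, p.2)

/-- Overriding a total assignment by a partial assignment. -/
def override (a : PA) (g : ℕ → Bool) : ℕ → Bool := fun v => (a v).getD (g v)

/-- The instantiated QBC `Φ[a]` = `P[a] : φ[a]`. -/
noncomputable def QBC.inst (Φ : QBC) (a : PA) : QBC :=
  ⟨instPrefix Φ.pfx a, fun g => Φ.matrix (override a g)⟩

/-- `P'` is a relaxation of the prefix `P`: a permutation of `P` such that
`y ⪯ x` implies `y ⪯' x` for every universal `y` and existential `x`. -/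
def IsRelaxationPfx (P P' : List (Quant × ℕ)) : Prop :=
  P.Perm P' ∧ ∀ y ∈ univVars P, ∀ x ∈ existVars P, preceq P y x → preceq P' y x

/-- `Φ'` is a relaxation of the QBC `Φ`. -/
def IsRelaxation (Φ Φ' : QBC) : Prop :=
  IsRelaxationPfx Φ.pfx Φ'.pfx ∧ Φ'.matrix = Φ.matrix

/-- Negation of a quantifier. -/
def Quant.neg : Quant → Quant
  | .all => .ex
  | .ex => .all

/-- `isAltFrom q i qs`: the quantifier string `qs` consists of (at most) `i`
alternating possibly-empty blocks, starting with a block of `q`s. -/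
def isAltFrom : Quant → ℕ → List Quant → Prop
  | _, 0, qs => qs = []
  | q, i + 1, qs => ∃ k rest, qs = List.replicate k q ++ rest ∧ isAltFrom q.neg i rest

/-- The prefix `P` is `Π_i`: its quantifier string lies in `∀*∃*∀*⋯` with `i`
alternating starred blocks beginning with `∀*`. -/
def isPiPrefix (i : ℕ) (P : List (Quant × ℕ)) : Prop :=
  isAltFrom Quant.all i (P.map Prod.fst)

/-- The axiom set `H(Φ, Π_k)`: the clauses `C` on variables of `Φ` such that
some `Π_k`-relaxation of `Φ[assign(C)]` is false. -/
def Hset (Φ : QBC) (k : ℕ) : Set PA :=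
  {C | (∀ v, C v ≠ none → v ∈ Φ.vars) ∧
    ∃ Φ' : QBC, IsRelaxation (Φ.inst C) Φ' ∧ isPiPrefix k Φ'.pfx ∧ Φ'.IsFalse}

/-- `g` is a semicompletion of `f` (relative to prefix `P`). -/
def SemiComp (P : List (Quant × ℕ)) (f g : PA) : Prop :=
  ExtendsPA g f ∧
  ∀ y ∈ univVars P, f y = none → domPrec P f y → (g y = none ∧ domPrec P g y)

/-- A set of partial assignments of `Φ` is semicompletion-closed. -/
def SemiCompClosed (Φ : QBC) (H : Set PA) : Prop :=
  ∀ f ∈ H, ∀ g : PA, (∀ v, g v ≠ none → v ∈ Φ.vars) → SemiComp Φ.pfx f g → g ∈ H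

/-- Delayer condition (semicompletion-of-empty). -/
def CondEmpty (Φ : QBC) (F : Set PA) (s : PA → ℕ) : Prop :=
  ∃ g ∈ F, SemiComp Φ.pfx emptyPA g ∧ s g = 0

/-- Delayer condition (monotonicity). -/
def CondMono (Φ : QBC) (F : Set PA) (s : PA → ℕ) : Prop :=
  ∀ g ∈ F, ∀ f' : PA, ExtendsPA g f' → ∃ f ∈ F, SemiComp Φ.pfx f' f ∧ s f ≤ s g

/-- Delayer condition (∀-branching). -/
def CondForallB (Φ : QBC) (F : Set PA) (s : PA → ℕ) : Prop :=
  ∀ f ∈ F, ∀ y ∈ univVars Φ.pfx, f y = none → domPrec Φ.pfx f y →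
    ∀ b : Bool, ∃ g ∈ F, SemiComp Φ.pfx (Function.update f y (some b)) g ∧ s g = s f

/-- Delayer condition (double-branching). -/
def CondDoubleB (Φ : QBC) (F : Set PA) (s : PA → ℕ) : Prop :=
  ∀ f ∈ F, ∀ v ∈ Φ.vars, f v = none →
    ∃ b : Bool, ∃ g ∈ F, SemiComp Φ.pfx (Function.update f v (some b)) g ∧
      s g ≤ s f + 1 ∧
      (s g = s f + 1 →
        ∃ g' ∈ F, SemiComp Φ.pfx (Function.update f v (some (!b))) g' ∧ s g' ≤ s f + 1)

/-- A `p`-point delayer strategy for `Φ` with respect to axiom set `H`. -/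
def IsDelayer (Φ : QBC) (H : Set PA) (p : ℕ) (F : Set PA) (s : PA → ℕ) : Prop :=
  (∀ f ∈ F, ∀ v, f v ≠ none → v ∈ Φ.vars) ∧
  CondEmpty Φ F s ∧ (∀ f ∈ F, f ∈ H → p ≤ s f) ∧
  CondMono Φ F s ∧ CondForallB Φ F s ∧ CondDoubleB Φ F s

/-! The separation formulas `Φₙ` of Section 6. -/

/-- The variable `x_{i,j,k}`. -/
def xV (i : ℕ) (j k : Bool) : ℕ := 9 * i + 2 * cond j 1 0 + cond k 1 0

/-- The variable `x'_{i,j,k}`. -/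
def xV' (i : ℕ) (j k : Bool) : ℕ := 9 * i + 4 + 2 * cond j 1 0 + cond k 1 0

/-- The variable `yᵢ`. -/
def yV (i : ℕ) : ℕ := 9 * i + 8

/-- A block of four quantified variables. -/
def blockOf (q : Quant) (f : Bool → Bool → ℕ) : List (Quant × ℕ) :=
  [(q, f false false), (q, f false true), (q, f true false), (q, f true true)]

/-- The prefix `∃X₀ ∃X'₁∀y₁∃X₁ ⋯ ∃X'ₙ∀yₙ∃Xₙ`. -/
def sepPrefix (n : ℕ) : List (Quant × ℕ) :=
  blockOf Quant.ex (xV 0) ++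
    (List.range n).flatMap fun i =>
      blockOf Quant.ex (xV' (i + 1)) ++ [(Quant.all, yV (i + 1))] ++
        blockOf Quant.ex (xV (i + 1))

/-- The clause `¬x_{0,j,k}` (as its falsifying assignment). -/
def clB1 (j k : Bool) : PA := fun v => if v = xV 0 j k then some true else none

/-- The clause `x_{n,j,0} ∨ x_{n,j,1}`. -/
def clB2 (n : ℕ) (j : Bool) : PA :=
  fun v => if v = xV n j false ∨ v = xV n j true then some false else none

/-- The clause `¬x'_{i,0,k} ∨ ¬x'_{i,1,l} ∨ x_{i−1,j,0} ∨ x_{i−1,j,1}`. -/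
def clH (i : ℕ) (j k l : Bool) : PA := fun v =>
  if v = xV' i false k ∨ v = xV' i true l then some true
  else if v = xV (i - 1) j false ∨ v = xV (i - 1) j true then some false
  else none

/-- For `j = false` the clause `¬x_{i,0,k} ∨ yᵢ ∨ x'_{i,0,k}`; for `j = true`
the clause `¬x_{i,1,k} ∨ ¬yᵢ ∨ x'_{i,1,k}`. -/
def clT (i : ℕ) (j k : Bool) : PA := fun v =>
  if v = xV i j k then some true
  else if v = yV i then some j
  else if v = xV' i j k then some false
  else none

/-- The set `Tᵢ` of clauses. -/
def Tset (i : ℕ) : Set PA := {C | ∃ j k : Bool, C = clT i j k}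

/-- The set of clauses of the matrix `φₙ`. -/
def sepClauses (n : ℕ) : Set PA :=
  {C | (∃ j k : Bool, C = clB1 j k) ∨ (∃ j : Bool, C = clB2 n j) ∨
    (∃ i, 1 ≤ i ∧ i ≤ n ∧ ∃ j k l : Bool, C = clH i j k l) ∨
    (∃ i, 1 ≤ i ∧ i ≤ n ∧ ∃ j k : Bool, C = clT i j k)}

/-- The separation formula `Φₙ`. -/
def sepQBC (n : ℕ) : QBC :=
  ⟨sepPrefix n, fun g => ∀ C ∈ sepClauses n, ¬ TotalExtends g C⟩

/-- The level-`i` variables `X'ᵢ ∪ {yᵢ} ∪ Xᵢ`. -/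
def levelVars (i : ℕ) : List ℕ :=
  [xV' i false false, xV' i false true, xV' i true false, xV' i true true, yV i,
   xV i false false, xV i false true, xV i true false, xV i true true]

/-- `r` is defined exactly on the level-`i` variables. -/
def OnLevel (i : ℕ) (r : PA) : Prop := ∀ v, r v ≠ none ↔ v ∈ levelVars i

/-- A normal realization of level `i`. -/
def NormalReal (i : ℕ) (r : PA) : Prop :=
  OnLevel i r ∧ ∃ b : Bool, r (yV i) = some b ∧
    r (xV i b false) = some false ∧ r (xV' i b false) = some false ∧
    r (xV i b true) = some false ∧ r (xV' i b true) = some false ∧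
    ∃ c : Bool, r (xV i (!b) false) = some c ∧ r (xV' i (!b) false) = some c ∧
      r (xV i (!b) true) = some (!c) ∧ r (xV' i (!b) true) = some (!c)

/-- A funny realization of level `i`. -/
def FunnyReal (i : ℕ) (r : PA) : Prop :=
  OnLevel i r ∧ ∃ b : Bool, r (yV i) = some b ∧
    (∃ c : Bool, r (xV i b false) = some c ∧ r (xV' i b false) = some c ∧
      r (xV i b true) = some (!c) ∧ r (xV' i b true) = some (!c)) ∧
    r (xV' i (!b) false) = some false ∧ r (xV' i (!b) true) = some false ∧
    ∃ d : Bool, r (xV i (!b) false) = some d ∧ r (xV i (!b) true) = some (!d)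

/-- Restriction of a partial assignment to the level-`i` variables. -/
def restrictLevel (i : ℕ) (f : PA) : PA :=
  fun v => if v ∈ levelVars i then f v else none

-- The maximum level `ℓ` containing an existentially quantified variable of
-- `dom f` (and `0` if there is none).
open Classical in
noncomputable def maxLevel (n : ℕ) (f : PA) : ℕ :=
  ((Finset.Icc 1 n).filter fun i => ∃ v ∈ levelVars i, v ≠ yV i ∧ f v ≠ none).sup id

/-- `f` is half-defined on level `ℓ`. -/
def HalfDefined (ℓ : ℕ) (f : PA) : Prop :=
  (∀ j k : Bool, f (xV ℓ j k) = none) ∧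
  (∃ j k : Bool, f (xV' ℓ j k) = some true ∧
    ∀ j' k' : Bool, (j', k') ≠ (j, k) → f (xV' ℓ j' k') = some false)

/-- A normal assignment of `Φₙ`. -/
def NormalAssign (n : ℕ) (f : PA) : Prop :=
  (∀ v, f v ≠ none → v ∈ (sepPrefix n).map Prod.snd) ∧
  (∀ j k : Bool, f (xV 0 j k) = some false) ∧
  (∀ i, 1 ≤ i → i + 1 ≤ maxLevel n f → NormalReal i (restrictLevel i f)) ∧
  (1 ≤ maxLevel n f →
    (NormalReal (maxLevel n f) (restrictLevel (maxLevel n f) f) ∨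
      HalfDefined (maxLevel n f) f))

/-- A funny assignment of `Φₙ`, with witness `m` (so that `sₙ(f) = m`). -/
def FunnyAssign (n : ℕ) (f : PA) (m : ℕ) : Prop :=
  (∀ v, f v ≠ none → v ∈ (sepPrefix n).map Prod.snd) ∧
  1 ≤ m ∧ m ≤ maxLevel n f ∧
  (∀ j k : Bool, f (xV 0 j k) = some false) ∧
  (∀ i, 1 ≤ i → i < m → NormalReal i (restrictLevel i f)) ∧
  FunnyReal m (restrictLevel m f) ∧
  (∀ i, m < i → i ≤ maxLevel n f → ∀ j : Bool,
    ((f (xV i j false) ≠ none ∨ f (xV i j true) ≠ none ∨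
      f (xV' i j false) ≠ none ∨ f (xV' i j true) ≠ none) →
      ∃ c : Bool, f (xV i j false) = some c ∧ f (xV' i j false) = some c ∧
        f (xV i j true) = some (!c) ∧ f (xV' i j true) = some (!c)))

/-- The set `Fₙ` of normal and funny assignments. -/
def Fset (n : ℕ) : Set PA := {f | NormalAssign n f ∨ ∃ m, FunnyAssign n f m}

-- The score function `sₙ`.
open Classical in
noncomputable def score (n : ℕ) (f : PA) : ℕ :=
  if h : ∃ m, FunnyAssign n f m then h.choose else maxLevel n f

/-! The mod-3 formulas `Ψₙ` of Section 7 (variables `xᵢ = 2i`, `yᵢ = 2i+1`). -/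

/-- The prefix `∃x₁∀y₁⋯∃xₙ∀yₙ`. -/
def modPrefix (n : ℕ) : List (Quant × ℕ) :=
  (List.range n).flatMap fun i =>
    [(Quant.ex, 2 * (i + 1)), (Quant.all, 2 * (i + 1) + 1)]

/-- Numeric value of a Boolean. -/
def boolVal (b : Bool) : ℕ := cond b 1 0

/-- The matrix `φ_{n,j}`: true iff `j + Σᵢ (xᵢ + yᵢ) ≢ n (mod 3)`. -/
def modMatrix (n j : ℕ) (g : ℕ → Bool) : Prop :=
  ¬ ((j + ∑ i ∈ Finset.Icc 1 n, (boolVal (g (2 * i)) + boolVal (g (2 * i + 1)))) % 3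
      = n % 3)

/-- The mod-3 formula `Ψₙ`. -/
def modQBC (n : ℕ) : QBC := ⟨modPrefix n, modMatrix n 0⟩

/-! ### Variables -/

theorem var_cases (v : ℕ) : (∃ i j k, v = xV i j k) ∨ (∃ i j k, v = xV' i j k) ∨ ∃ i, v = yV i := by
  have h9 : v % 9 < 9 := Nat.mod_lt _ (by norm_num)
  have hv := Nat.div_add_mod v 9
  generalize v / 9 = i at *
  generalize v % 9 = r at *
  interval_cases r
  · exact Or.inl ⟨i, false, false, by simp [xV]; omega⟩
  · exact Or.inl ⟨i, false, true, by simp [xV]; omega⟩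
  · exact Or.inl ⟨i, true, false, by simp [xV]; omega⟩
  · exact Or.inl ⟨i, true, true, by simp [xV]; omega⟩
  · exact Or.inr (Or.inl ⟨i, false, false, by simp [xV']; omega⟩)
  · exact Or.inr (Or.inl ⟨i, false, true, by simp [xV']; omega⟩)
  · exact Or.inr (Or.inl ⟨i, true, false, by simp [xV']; omega⟩)
  · exact Or.inr (Or.inl ⟨i, true, true, by simp [xV']; omega⟩)
  · exact Or.inr (Or.inr ⟨i, by simp [yV]; omega⟩)

theorem xV_inj {i j k i' j' k'} : xV i j k = xV i' j' k' ↔ i = i' ∧ j = j' ∧ k = k' := by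
  cases j <;> cases k <;> cases j' <;> cases k' <;> simp [xV] <;> omega

theorem xV'_inj {i j k i' j' k'} : xV' i j k = xV' i' j' k' ↔ i = i' ∧ j = j' ∧ k = k' := by
  cases j <;> cases k <;> cases j' <;> cases k' <;> simp [xV'] <;> omega

theorem yV_inj {i i'} : yV i = yV i' ↔ i = i' := by
  simp [yV]

theorem xV_ne_xV' {i j k i' j' k'} : xV i j k ≠ xV' i' j' k' := by
  cases j <;> cases k <;> cases j' <;> cases k' <;> simp [xV, xV'] <;> omega

theorem xV_ne_yV {i j k i'} : xV i j k ≠ yV i' := by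
  cases j <;> cases k <;> simp [xV, yV] <;> omega

theorem xV'_ne_yV {i j k i'} : xV' i j k ≠ yV i' := by
  cases j <;> cases k <;> simp [xV', yV] <;> omega

/-- Position of a variable in the prefix (shifted by 5). -/
def posV (v : ℕ) : ℕ := 9 * (v / 9) + (v % 9 + 5) % 9

/-- Inverse of `posV`. -/
def invV (p : ℕ) : ℕ := 9 * (p / 9) + (p % 9 + 4) % 9

/-- The quantifier of a variable. -/
def quantV (v : ℕ) : Quant := if v % 9 = 8 then Quant.all else Quant.ex

theorem posV_invV (p : ℕ) : posV (invV p) = p := by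
  unfold posV invV; omega

theorem invV_posV (p : ℕ) : invV (posV p) = p := by
  unfold posV invV; omega

theorem posV_inj {u v : ℕ} (h : posV u = posV v) : u = v := by
  rw [← invV_posV u, h, invV_posV]

theorem pos_xV (i j k) : 9 * i + 5 ≤ posV (xV i j k) ∧ posV (xV i j k) ≤ 9 * i + 8 := by
  cases j <;> cases k <;> simp [posV, xV] <;> omega

theorem pos_xV' (i j k) : 9 * i ≤ posV (xV' i j k) ∧ posV (xV' i j k) ≤ 9 * i + 3 := by
  cases j <;> cases k <;> simp [posV, xV'] <;> omega

theorem pos_yV (i) : posV (yV i) = 9 * i + 4 := by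
  simp [posV, yV]; omega

theorem quant_xV (i j k) : quantV (xV i j k) = Quant.ex := by
  cases j <;> cases k <;> simp [quantV, xV] <;> omega

theorem quant_xV' (i j k) : quantV (xV' i j k) = Quant.ex := by
  cases j <;> cases k <;> simp [quantV, xV'] <;> omega

theorem quant_yV (i) : quantV (yV i) = Quant.all := by
  simp [quantV, yV]

theorem sepPrefix_eq (n : ℕ) :
    sepPrefix n = (List.range' 5 (9 * n + 4)).map fun p => (quantV (invV p), invV p) := by
  induction n with
  | zero => simp [sepPrefix, List.range', blockOf, xV, quantV, invV]
  | succ n ih =>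
    have h1 : sepPrefix (n + 1) = sepPrefix n ++ (blockOf Quant.ex (xV' (n + 1)) ++
        [(Quant.all, yV (n + 1))] ++ blockOf Quant.ex (xV (n + 1))) := by
      simp [sepPrefix, List.range_succ]
    have h2 : List.range' 5 (9 * (n + 1) + 4) = List.range' 5 (9 * n + 4) ++
        List.range' (9 * (n + 1)) 9 := by
      rw [show 9 * (n + 1) + 4 = (9 * n + 4) + 9 by ring, ← List.range'_append]
      congr 2; ring
    rw [h1, h2, ih, List.map_append]
    congr 1
    have e : ∀ r, r < 9 → invV (9 * (n + 1) + r) = 9 * (n + 1) + (r + 4) % 9 := by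
      intro r hr; unfold invV; omega
    have e' : ∀ r, r < 9 → quantV (9 * (n + 1) + r) = if r = 8 then Quant.all else Quant.ex := by
      intro r hr; unfold quantV
      have : (9 * (n + 1) + r) % 9 = r := by omega
      rw [this]
    have e0 := e 0 (by norm_num)
    have e0' := e' 0 (by norm_num)
    simp only [add_zero] at e0 e0'
    simp [List.range', blockOf, xV, xV', yV, add_assoc, e, e', e0, e0']

theorem sep_get (n p : ℕ) : (sepPrefix n)[p]? =
    if p < 9 * n + 4 then some (quantV (invV (p + 5)), invV (p + 5)) else none := by
  rw [sepPrefix_eq, List.getElem?_map]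
  split
  · rw [List.getElem?_range' (by assumption)]; simp [add_comm]
  · rw [List.getElem?_eq_none (by simp; omega)]; rfl

theorem mem_sep (n : ℕ) (q : Quant) (v : ℕ) :
    (q, v) ∈ sepPrefix n ↔ q = quantV v ∧ 5 ≤ posV v ∧ posV v < 9 * n + 9 := by
  rw [sepPrefix_eq]
  simp only [List.mem_map, List.mem_range'_1, Prod.mk.injEq]
  constructor
  · rintro ⟨p, hp, rfl, rfl⟩
    rw [posV_invV]; exact ⟨rfl, by omega, by omega⟩
  · rintro ⟨rfl, h⟩
    exact ⟨posV v, by omega, by rw [invV_posV], invV_posV v⟩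

theorem mem_sepvars (n : ℕ) (v : ℕ) :
    v ∈ (sepPrefix n).map Prod.snd ↔ 5 ≤ posV v ∧ posV v < 9 * n + 9 := by
  constructor
  · intro h
    obtain ⟨⟨q, w⟩, hw, rfl⟩ := List.mem_map.1 h
    exact ((mem_sep n q w).1 hw).2
  · intro h
    exact List.mem_map.2 ⟨(quantV v, v), (mem_sep n _ v).2 ⟨rfl, h⟩, rfl⟩

theorem sep_pairwise (n : ℕ) : (sepPrefix n).Pairwise fun a b => posV a.2 < posV b.2 := by
  rw [sepPrefix_eq, List.pairwise_map]
  simp only [posV_invV]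
  exact List.pairwise_lt_range'

theorem preceq_yV {n u i : ℕ} (h : preceq (sepPrefix n) u (yV i)) : posV u ≤ posV (yV i) := by
  obtain ⟨a, b, ha, hb, hab⟩ := h
  rw [sep_get] at ha hb
  split at ha
  swap
  · simp at ha
  split at hb
  swap
  · simp at hb
  simp only [Option.map_some, Option.some.injEq] at ha hb
  rw [← ha, ← hb, posV_invV, posV_invV]
  rcases hab with hab | ⟨hba, hk⟩
  · omega
  · exfalso
    have h1 := hk (b + 1) (by omega) (by omega)
    rw [sep_get, sep_get, if_pos (by omega), if_pos (by omega)] at h1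
    simp only [Option.map_some, Option.some.injEq, hb, quant_yV] at h1
    have h2 : b + 5 = 9 * i + 4 := by rw [← pos_yV, ← hb, posV_invV]
    have h3 : invV (b + 1 + 5) = 9 * i := by unfold invV; omega
    rw [h3] at h1
    simp [quantV] at h1

theorem preceq_of_pos {n u v : ℕ} (hu : 5 ≤ posV u) (hv : posV v < 9 * n + 9) (h : posV u ≤ posV v) :
    preceq (sepPrefix n) u v := by
  refine ⟨posV u - 5, posV v - 5, ?_, ?_, Or.inl (by omega)⟩
  · rw [sep_get, if_pos (by omega)]
    simp [show posV u - 5 + 5 = posV u by omega, invV_posV]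
  · rw [sep_get, if_pos (by omega)]
    simp [show posV v - 5 + 5 = posV v by omega, invV_posV]

theorem mem_univ_sep {n y : ℕ} (h : y ∈ univVars (sepPrefix n)) : ∃ i, y = yV i ∧ 1 ≤ i ∧ i ≤ n := by
  simp only [univVars, List.mem_map, List.mem_filter, decide_eq_true_eq] at h
  obtain ⟨⟨q, w⟩, ⟨hw, hq⟩, rfl⟩ := h
  rw [mem_sep] at hw
  simp only at hq ⊢
  obtain ⟨h1, h2, h3⟩ := hw
  have : w % 9 = 8 := by
    by_contra hne
    rw [hq, quantV, if_neg hne] at h1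
    cases h1
  refine ⟨w / 9, by unfold yV; omega, ?_, ?_⟩ <;> unfold posV at h2 h3 <;> omega

/-! ### The game -/

/-- The level functions agree with `C`. -/
def ExtC (C : PA) (X X' : ℕ → Bool → Bool → Bool) (Y : ℕ → Bool) : Prop :=
  (∀ i j k b, C (xV i j k) = some b → X i j k = b) ∧
  (∀ i j k b, C (xV' i j k) = some b → X' i j k = b) ∧
  (∀ i b, C (yV i) = some b → Y i = b)

def LowL (X X' : ℕ → Bool → Bool → Bool) (i : ℕ) : Prop :=
  (∀ j k, X i j k = X' i j k) ∧ ∃ j, ∀ k, X' i j k = false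

def HighL (X X' : ℕ → Bool → Bool → Bool) (i : ℕ) : Prop :=
  (∀ j k, X i j k = X' i j k) ∧ ∀ j, ∃ k, X i j k = true

def MidL (X X' : ℕ → Bool → Bool → Bool) (Y : ℕ → Bool) (i : ℕ) : Prop :=
  (∃ j, ∀ k, X' i j k = false) ∧ (∀ k, X i (Y i) k = true → X' i (Y i) k = true) ∧
    ∀ j, ∃ k, X i j k = true

/-- Existential variables of `C` have level at most `m`. -/
def ExLe (C : PA) (m : ℕ) : Prop :=
  ∀ i, m < i → ∀ j k, C (xV i j k) = none ∧ C (xV' i j k) = none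

def NState (C : PA) (m : ℕ) (X X' : ℕ → Bool → Bool → Bool) (Y : ℕ → Bool) : Prop :=
  ExtC C X X' Y ∧ (∀ j k, X 0 j k = false) ∧ (∀ i, 1 ≤ i → i ≤ m → LowL X X' i) ∧ ExLe C m

def Funny (m : ℕ) (X X' : ℕ → Bool → Bool → Bool) (Y : ℕ → Bool) : Prop :=
  (∀ j k, X 0 j k = false) ∧ (∀ i, 1 ≤ i → i < m → LowL X X' i) ∧
    1 ≤ m ∧ MidL X X' Y m ∧ ∀ i, m < i → HighL X X' i

def Good (C : PA) (s : ℕ) : Prop :=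
  ∃ X X' Y m, m ≤ s ∧ (NState C m X X' Y ∨ (ExtC C X X' Y ∧ Funny m X X' Y))

theorem ExtC.mono {C D : PA} (h : ExtendsPA C D) {X X' Y} (hC : ExtC C X X' Y) : ExtC D X X' Y :=
  ⟨fun i j k b e => hC.1 i j k b (h _ _ e), fun i j k b e => hC.2.1 i j k b (h _ _ e),
    fun i b e => hC.2.2 i b (h _ _ e)⟩

theorem ExtendsPA.none {C D : PA} (h : ExtendsPA C D) {v} (hv : C v = none) : D v = none := by
  cases e : D v with
  | none => rfl
  | some b => rw [h v b e] at hv; cases hv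

theorem Good.mono {C D : PA} (h : ExtendsPA C D) {s} (hC : Good C s) : Good D s := by
  obtain ⟨X, X', Y, m, hm, ⟨h1, h2, h3, h4⟩ | ⟨h1, h2⟩⟩ := hC
  · exact ⟨X, X', Y, m, hm, Or.inl ⟨h1.mono h, h2, h3, fun i hi j k =>
      ⟨h.none (h4 i hi j k).1, h.none (h4 i hi j k).2⟩⟩⟩
  · exact ⟨X, X', Y, m, hm, Or.inr ⟨h1.mono h, h2⟩⟩

theorem good_empty : Good emptyPA 0 := by
  refine ⟨fun _ _ _ => false, fun _ _ _ => false, fun _ => false, 0, le_rfl, Or.inl ⟨?_, ?_, ?_, ?_⟩⟩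
  · simp [ExtC, emptyPA]
  · simp
  · intro i h1 h2; omega
  · simp [ExLe, emptyPA]

/-- Truncation at level `i`. -/
theorem trunc {C : PA} {i : ℕ} {X X' Y} (hi : 1 ≤ i) (hext : ExtC C X X' Y)
    (h0 : ∀ j k, X 0 j k = false) (hlow : ∀ l, 1 ≤ l → l < i → LowL X X' l)
    (hz : ∃ j, ∀ k, X' i j k = false) (hle : ExLe C i) (hx : ∀ j k, C (xV i j k) = none) :
    ∃ Z, NState C i Z X' Y := by
  refine ⟨fun l => if l = i then X' i else X l, ⟨?_, hext.2.1, hext.2.2⟩, ?_, ?_, hle⟩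
  · intro l j k b e
    by_cases hl : l = i
    · subst hl; rw [hx] at e; cases e
    · simp only [if_neg hl]; exact hext.1 _ _ _ _ e
  · intro j k
    simp only [if_neg (show (0 : ℕ) ≠ i by omega)]; exact h0 j k
  · intro l h1 h2
    by_cases hl : l = i
    · subst hl; exact ⟨fun j k => by simp, hz⟩
    · have := hlow l h1 (by omega)
      exact ⟨fun j k => by simp only [if_neg hl]; exact this.1 j k, this.2⟩

theorem extC_update_y {C : PA} {X X' Y} (h : ExtC C X X' Y) (i : ℕ) (b : Bool) :
    ExtC (Function.update C (yV i) (some b)) X X' (Function.update Y i b) := by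
  refine ⟨fun l j k c e => ?_, fun l j k c e => ?_, fun l c e => ?_⟩
  · rw [Function.update_of_ne xV_ne_yV] at e; exact h.1 _ _ _ _ e
  · rw [Function.update_of_ne xV'_ne_yV] at e; exact h.2.1 _ _ _ _ e
  · by_cases hl : l = i
    · subst hl; simp at e ⊢; exact e
    · rw [Function.update_of_ne (fun h' => hl (yV_inj.1 h'))] at e
      rw [Function.update_of_ne hl]; exact h.2.2 _ _ e

theorem good_elim {n : ℕ} {C D : PA} {s : ℕ} (hC : Good C s) (h : ForallElim (sepPrefix n) C D) :
    Good D s := by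
  obtain ⟨y, b, hy, hCy, rfl, hprec⟩ := h
  obtain ⟨i, rfl, hi1, hin⟩ := mem_univ_sep hy
  have hx : ∀ l, i ≤ l → ∀ j k, C (xV l j k) = none := by
    intro l hl j k
    by_contra hne
    have h1 := preceq_yV (hprec _ hne)
    have h2 := pos_xV l j k
    rw [pos_yV] at h1; omega
  have hx' : ∀ l, i < l → ∀ j k, C (xV' l j k) = none := by
    intro l hl j k
    by_contra hne
    have h1 := preceq_yV (hprec _ hne)
    have h2 := pos_xV' l j k
    rw [pos_yV] at h1; omega
  have upd : ∀ m, ExLe C m → ExLe (Function.update C (yV i) (some b)) m := by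
    intro m hm l hl j k
    rw [Function.update_of_ne xV_ne_yV, Function.update_of_ne xV'_ne_yV]
    exact hm l hl j k
  have hle : ExLe C i := fun l hl j k => ⟨hx l hl.le j k, hx' l hl j k⟩
  obtain ⟨X, X', Y, m, hm, ⟨h1, h2, h3, h4⟩ | ⟨h1, h2, h3, h4, h5, h6⟩⟩ := hC
  · exact ⟨X, X', Function.update Y i b, m, hm,
      Or.inl ⟨extC_update_y h1 i b, h2, h3, upd m h4⟩⟩
  · by_cases him : i ≤ m
    · have hz : ∃ j, ∀ k, X' i j k = false := by
        rcases him.lt_or_eq with h | rfl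
        · exact (h3 i hi1 h).2
        · exact h5.1
      obtain ⟨Z, hZ⟩ := trunc hi1 h1 h2 (fun l a c => h3 l a (by omega)) hz hle (hx i le_rfl)
      exact ⟨Z, X', Function.update Y i b, i, by omega,
        Or.inl ⟨extC_update_y hZ.1 i b, hZ.2.1, hZ.2.2.1, upd i hZ.2.2.2⟩⟩
    · refine ⟨X, X', Function.update Y i b, m, hm,
        Or.inr ⟨extC_update_y h1 i b, h2, h3, h4, ?_, h6⟩⟩
      have : Function.update Y i b m = Y m := Function.update_of_ne (by omega) _ _
      unfold MidL at h5 ⊢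
      rw [this]; exact h5

/-- Value of a variable. -/
theorem ext_update {C : PA} {X X' Y} (v : ℕ) (h : ExtC C X X' Y) :
    ∃ b, ∀ c, c = b → ExtC (Function.update C v (some c)) X X' Y := by
  rcases var_cases v with ⟨i, j, k, rfl⟩ | ⟨i, j, k, rfl⟩ | ⟨i, rfl⟩
  · refine ⟨X i j k, ?_⟩
    rintro c rfl
    refine ⟨fun l j' k' c e => ?_, fun l j' k' c e => ?_, fun l c e => ?_⟩
    · by_cases hl : xV l j' k' = xV i j k
      · obtain ⟨rfl, rfl, rfl⟩ := xV_inj.1 hl; simpa using e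
      · rw [Function.update_of_ne hl] at e; exact h.1 _ _ _ _ e
    · rw [Function.update_of_ne xV_ne_xV'.symm] at e; exact h.2.1 _ _ _ _ e
    · rw [Function.update_of_ne xV_ne_yV.symm] at e; exact h.2.2 _ _ e
  · refine ⟨X' i j k, ?_⟩
    rintro c rfl
    refine ⟨fun l j' k' c e => ?_, fun l j' k' c e => ?_, fun l c e => ?_⟩
    · rw [Function.update_of_ne xV_ne_xV'] at e; exact h.1 _ _ _ _ e
    · by_cases hl : xV' l j' k' = xV' i j k
      · obtain ⟨rfl, rfl, rfl⟩ := xV'_inj.1 hl; simpa using e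
      · rw [Function.update_of_ne hl] at e; exact h.2.1 _ _ _ _ e
    · rw [Function.update_of_ne xV'_ne_yV.symm] at e; exact h.2.2 _ _ e
  · refine ⟨Y i, ?_⟩
    rintro c rfl
    have := extC_update_y h i (Y i)
    rwa [Function.update_eq_self] at this

/-- The branching analysis at a query of the existential variable `v = x_{i,j,k}` or `x'_{i,j,k}`
above the current level. -/
theorem branch {C D : PA} {m i : ℕ} {X X' Y} (h : NState C m X X' Y) (him : m < i) (j k c : Bool)
    (hD : D = Function.update C (xV i j k) (some c) ∨ D = Function.update C (xV' i j k) (some c)) :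
    Good D (m + 1) := by
  obtain ⟨h1, h2, h3, h4⟩ := h
  have hXl : ∀ l j' k' b, D (xV l j' k') = some b →
      (l ≤ m ∧ C (xV l j' k') = some b) ∨ (l = i ∧ j' = j ∧ k' = k ∧ b = c) := by
    intro l j' k' b e
    have : C (xV l j' k') = some b ∨ (l = i ∧ j' = j ∧ k' = k ∧ b = c) := by
      rcases hD with rfl | rfl
      · by_cases hl : xV l j' k' = xV i j k
        · rw [hl] at e; simp at e
          obtain ⟨rfl, rfl, rfl⟩ := xV_inj.1 hl; exact Or.inr ⟨rfl, rfl, rfl, e.symm⟩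
        · rw [Function.update_of_ne hl] at e; exact Or.inl e
      · rw [Function.update_of_ne xV_ne_xV'] at e; exact Or.inl e
    rcases this with e' | e'
    · refine Or.inl ⟨?_, e'⟩
      by_contra hl
      rw [(h4 l (by omega) j' k').1] at e'; cases e'
    · exact Or.inr e'
  have hXl' : ∀ l j' k' b, D (xV' l j' k') = some b →
      (l ≤ m ∧ C (xV' l j' k') = some b) ∨ (l = i ∧ j' = j ∧ k' = k ∧ b = c) := by
    intro l j' k' b e
    have : C (xV' l j' k') = some b ∨ (l = i ∧ j' = j ∧ k' = k ∧ b = c) := by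
      rcases hD with rfl | rfl
      · rw [Function.update_of_ne xV_ne_xV'.symm] at e; exact Or.inl e
      · by_cases hl : xV' l j' k' = xV' i j k
        · rw [hl] at e; simp at e
          obtain ⟨rfl, rfl, rfl⟩ := xV'_inj.1 hl; exact Or.inr ⟨rfl, rfl, rfl, e.symm⟩
        · rw [Function.update_of_ne hl] at e; exact Or.inl e
    rcases this with e' | e'
    · refine Or.inl ⟨?_, e'⟩
      by_contra hl
      rw [(h4 l (by omega) j' k').2] at e'; cases e'
    · exact Or.inr e'
  have hYl : ∀ l b, D (yV l) = some b → Y l = b := by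
    intro l b e
    rcases hD with rfl | rfl
    · rw [Function.update_of_ne xV_ne_yV.symm] at e; exact h1.2.2 _ _ e
    · rw [Function.update_of_ne xV'_ne_yV.symm] at e; exact h1.2.2 _ _ e
  by_cases hi : i = m + 1
  · subst hi
    refine ⟨fun l j' k' => if l ≤ m then X l j' k' else (j' == j && k' == k && c),
      fun l j' k' => if l ≤ m then X' l j' k' else (j' == j && k' == k && c), Y, m + 1, le_rfl,
      Or.inl ⟨⟨?_, ?_, hYl⟩, ?_, ?_, ?_⟩⟩
    · intro l j' k' b e
      rcases hXl l j' k' b e with ⟨hl, e'⟩ | ⟨rfl, rfl, rfl, rfl⟩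
      · simp only [if_pos hl]; exact h1.1 _ _ _ _ e'
      · simp
    · intro l j' k' b e
      rcases hXl' l j' k' b e with ⟨hl, e'⟩ | ⟨rfl, rfl, rfl, rfl⟩
      · simp only [if_pos hl]; exact h1.2.1 _ _ _ _ e'
      · simp
    · intro j' k'; simp only [Nat.zero_le, if_true]; exact h2 j' k'
    · intro l hl1 hl2
      by_cases hl : l ≤ m
      · have := h3 l hl1 hl
        unfold LowL
        simp only [if_pos hl]; exact this
      · unfold LowL
        simp only [if_neg hl]
        refine ⟨fun _ _ => by simp, !j, fun k' => by simp⟩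
    · intro l hl j' k'
      constructor
      · cases e : D (xV l j' k') with
        | none => rfl
        | some b => rcases hXl l j' k' b e with h | h <;> omega
      · cases e : D (xV' l j' k') with
        | none => rfl
        | some b => rcases hXl' l j' k' b e with h | h <;> omega
  · refine ⟨fun l j' k' => if l ≤ m then X l j' k' else if l = m + 1 then true
        else if k' = k then c else true,
      fun l j' k' => if l ≤ m then X' l j' k' else if l = m + 1 then (j' == Y l)
        else if k' = k then c else true, Y, m + 1, le_rfl,
      Or.inr ⟨⟨?_, ?_, hYl⟩, ?_, ?_, by omega, ?_, ?_⟩⟩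
    · intro l j' k' b e
      rcases hXl l j' k' b e with ⟨hl, e'⟩ | ⟨rfl, rfl, rfl, rfl⟩
      · simp only [if_pos hl]; exact h1.1 _ _ _ _ e'
      · simp [hi]; omega
    · intro l j' k' b e
      rcases hXl' l j' k' b e with ⟨hl, e'⟩ | ⟨rfl, rfl, rfl, rfl⟩
      · simp only [if_pos hl]; exact h1.2.1 _ _ _ _ e'
      · simp [hi]; omega
    · intro j' k'; simp only [Nat.zero_le, if_true]; exact h2 j' k'
    · intro l hl1 hl2
      have hl : l ≤ m := by omega
      have := h3 l hl1 hl
      unfold LowL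
      simp only [if_pos hl]; exact this
    · unfold MidL
      simp only [if_neg (show ¬ (m + 1 ≤ m) by omega), if_true]
      exact ⟨⟨!(Y (m + 1)), fun k' => by simp⟩, fun k' _ => by simp, fun j' => ⟨true, by simp⟩⟩
    · intro l hl
      unfold HighL
      simp only [if_neg (show ¬ (l ≤ m) by omega), if_neg (show ¬ (l = m + 1) by omega)]
      exact ⟨fun _ _ => by simp, fun j' => ⟨!k, by simp⟩⟩

theorem Good.le {C : PA} {s t : ℕ} (h : Good C s) (hst : s ≤ t) : Good C t := by
  obtain ⟨X, X', Y, m, hm, h⟩ := h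
  exact ⟨X, X', Y, m, by omega, h⟩

theorem good_branch {C : PA} {s : ℕ} (hC : Good C s) (v : ℕ) :
    (∃ b, Good (Function.update C v (some b)) s) ∨
      ∀ b, Good (Function.update C v (some b)) (s + 1) := by
  obtain ⟨X, X', Y, m, hm, hN | ⟨h1, h2⟩⟩ := hC
  · obtain ⟨h1, h2, h3, h4⟩ := hN
    obtain ⟨b, hb⟩ := ext_update v h1
    have key : ExLe (Function.update C v (some b)) m → ∃ b, Good (Function.update C v (some b)) s :=
      fun h => ⟨b, X, X', Y, m, hm, Or.inl ⟨hb b rfl, h2, h3, h⟩⟩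
    rcases var_cases v with ⟨i, j, k, rfl⟩ | ⟨i, j, k, rfl⟩ | ⟨i, rfl⟩
    · by_cases hi : m < i
      · exact Or.inr fun c => (branch ⟨h1, h2, h3, h4⟩ hi j k c (Or.inl rfl)).le (by omega)
      · refine Or.inl (key fun l hl j' k' => ?_)
        rw [Function.update_of_ne (fun h => by have := xV_inj.1 h; omega),
          Function.update_of_ne xV_ne_xV'.symm]
        exact h4 l hl j' k'
    · by_cases hi : m < i
      · exact Or.inr fun c => (branch ⟨h1, h2, h3, h4⟩ hi j k c (Or.inr rfl)).le (by omega)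
      · refine Or.inl (key fun l hl j' k' => ?_)
        rw [Function.update_of_ne xV_ne_xV',
          Function.update_of_ne (fun h => by have := xV'_inj.1 h; omega)]
        exact h4 l hl j' k'
    · refine Or.inl (key fun l hl j' k' => ?_)
      rw [Function.update_of_ne xV_ne_yV, Function.update_of_ne xV'_ne_yV]
      exact h4 l hl j' k'
  · obtain ⟨b, hb⟩ := ext_update v h1
    exact Or.inl ⟨b, X, X', Y, m, hm, Or.inr ⟨hb b rfl, h2⟩⟩

theorem good_res {γ α β : PA} {v s : ℕ} (hr : IsResolvent γ α β v) (hg : Good γ s) :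
    Good α s ∨ Good β s ∨ (Good α (s + 1) ∧ Good β (s + 1)) := by
  obtain ⟨b, ha, hb, _, hu, hc⟩ := hr
  have e1 : ExtendsPA (Function.update γ v (some b)) α := by
    intro u c e
    by_cases huv : u = v
    · subst huv; rw [ha] at e; simpa using e
    · rw [Function.update_of_ne huv, hu u huv, e]; rfl
  have e2 : ExtendsPA (Function.update γ v (some (!b))) β := by
    intro u c e
    by_cases huv : u = v
    · subst huv; rw [hb] at e; simpa using e
    · rw [Function.update_of_ne huv, hu u huv]
      cases h : α u with
      | none => exact e
      | some c' => rw [hc u huv c' c h e]; rfl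
  rcases good_branch hg v with ⟨c, h⟩ | h
  · by_cases hcb : c = b
    · subst hcb; exact Or.inl (h.mono e1)
    · have : c = !b := by cases c <;> cases b <;> simp_all
      subst this; exact Or.inr (Or.inl (h.mono e2))
  · exact Or.inr (Or.inr ⟨(h b).mono e1, (h (!b)).mono e2⟩)

/-! ### Counting leaves -/

def leavesOf (L : List QUStep) (i : ℕ) : Set ℕ := {k | isSink L k ∧ Relation.ReflTransGen (edge L) i k}

theorem sink_finite (L : List QUStep) : {k | isSink L k}.Finite :=
  (Set.finite_lt_nat L.length).subset fun _ h => h.1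

theorem leavesOf_finite (L : List QUStep) (i : ℕ) : (leavesOf L i).Finite :=
  (sink_finite L).subset fun _ h => h.1

theorem leaves_sub {L : List QUStep} {i j : ℕ} (h : edge L i j) : leavesOf L j ⊆ leavesOf L i :=
  fun _ hk => ⟨hk.1, Relation.ReflTransGen.head h hk.2⟩

theorem edge_lt {P H} {L : List QUStep} (hv : ∀ i, validStep P H L i) {i j : ℕ} (h : edge L i j) :
    j < i := by
  have := hv i
  unfold validStep at this
  unfold edge at h
  cases e : L[i]? with
  | none => simp [e] at h
  | some st =>
    cases st with
    | ax C => simp [e] at h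
    | elim C s => simp [e] at h this; omega
    | res C s t v => simp [e] at h this; omega

theorem reach_le {P H} {L : List QUStep} (hv : ∀ i, validStep P H L i) {i j : ℕ}
    (h : Relation.ReflTransGen (edge L) i j) : j ≤ i := by
  induction h with
  | refl => exact le_rfl
  | tail _ h ih => exact (edge_lt hv h).le.trans ih

theorem no_reach {P H} {L : List QUStep} (hv : ∀ i, validStep P H L i) (ht : TreeLike L) {i j k : ℕ}
    (hj : edge L i j) (hk : edge L i k) (hjk : j ≠ k) : ¬ Relation.ReflTransGen (edge L) j k := by
  intro h
  rcases Relation.ReflTransGen.cases_tail h with h | ⟨c, hc, hck⟩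
  · exact hjk h.symm
  · have : c = i := ht k hck hk
    subst this
    have := reach_le hv hc
    have := edge_lt hv hj
    omega

theorem leaves_disjoint {P H} {L : List QUStep} (hv : ∀ i, validStep P H L i) (ht : TreeLike L)
    {i j k : ℕ} (hj : edge L i j) (hk : edge L i k) (hjk : j ≠ k) :
    Disjoint (leavesOf L j) (leavesOf L k) := by
  rw [Set.disjoint_left]
  rintro a ⟨_, h1⟩ ⟨_, h2⟩
  have tot : ∀ {a}, Relation.ReflTransGen (edge L) j a → Relation.ReflTransGen (edge L) k a →
      Relation.ReflTransGen (edge L) j k ∨ Relation.ReflTransGen (edge L) k j := by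
    intro a h1
    induction h1 with
    | refl => exact fun h => Or.inr h
    | @tail b c hb hbc ih =>
      intro h2
      rcases Relation.ReflTransGen.cases_tail h2 with h | ⟨d, hd, hdc⟩
      · subst h; exact Or.inl (hb.tail hbc)
      · have : d = b := ht _ hdc hbc
        subst this; exact ih hd
  rcases tot h1 h2 with h | h
  · exact no_reach hv ht hj hk hjk h
  · exact no_reach hv ht hk hj hjk.symm h

theorem leaf_count {n : ℕ} {H : Set PA} {L : List QUStep} {p : ℕ}
    (hH : ∀ C ∈ H, ∀ s, Good C s → p ≤ s)
    (hv : ∀ i, validStep (sepPrefix n) H L i) (ht : TreeLike L) :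
    ∀ i C s, stepClause? L i = some C → Good C s → 2 ^ (p - s) ≤ (leavesOf L i).ncard := by
  intro i
  induction i using Nat.strong_induction_on with
  | _ i ih =>
  intro C s hC hg
  have hvi := hv i
  unfold validStep at hvi
  unfold stepClause? at hC
  have sub : ∀ j, edge L i j → (leavesOf L j).ncard ≤ (leavesOf L i).ncard := fun j hj =>
    Set.ncard_le_ncard (leaves_sub hj) (leavesOf_finite L i)
  cases e : L[i]? with
  | none => simp [e] at hC
  | some st =>
    rw [e] at hvi hC
    cases st with
    | ax D =>
      simp only [Option.map_some, QUStep.clause, Option.some.injEq] at hC hvi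
      subst hC
      have := hH D hvi s hg
      rw [Nat.sub_eq_zero_of_le this, pow_zero]
      have hi : i ∈ leavesOf L i := by
        refine ⟨⟨?_, ?_⟩, Relation.ReflTransGen.refl⟩
        · by_contra hlt
          rw [List.getElem?_eq_none (by omega)] at e; cases e
        · intro j hj; simp [edge, e] at hj
      exact (Set.ncard_pos (leavesOf_finite L i)).2 ⟨i, hi⟩
    | elim D j =>
      simp only [Option.map_some, QUStep.clause, Option.some.injEq] at hC hvi
      subst hC
      obtain ⟨hj, D', hD', hel⟩ := hvi
      exact (ih j hj D' s hD' (good_elim hg hel)).trans (sub j (by simp [edge, e]))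
    | res D j k v =>
      simp only [Option.map_some, QUStep.clause, Option.some.injEq] at hC hvi
      subst hC
      obtain ⟨hj, hk, α, β, hα, hβ, hr⟩ := hvi
      have ej : edge L i j := by simp [edge, e]
      have ek : edge L i k := by simp [edge, e]
      rcases good_res hr hg with h | h | ⟨h1, h2⟩
      · exact (ih j hj α s hα h).trans (sub j ej)
      · exact (ih k hk β s hβ h).trans (sub k ek)
      · have hjk : j ≠ k := by
          rintro rfl
          rw [hα] at hβ
          cases hβ
          obtain ⟨b, ha, hb, _⟩ := hr
          rw [ha] at hb; cases b <;> simp at hb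
        have hd := leaves_disjoint hv ht ej ek hjk
        have hu := Set.ncard_union_eq hd (leavesOf_finite L j) (leavesOf_finite L k)
        have hle : (leavesOf L j ∪ leavesOf L k).ncard ≤ (leavesOf L i).ncard :=
          Set.ncard_le_ncard (Set.union_subset (leaves_sub ej) (leaves_sub ek)) (leavesOf_finite L i)
        have a1 := ih j hj α _ hα h1
        have a2 := ih k hk β _ hβ h2
        have a3 : 2 ^ (p - s) ≤ 2 * 2 ^ (p - (s + 1)) := by
          rw [← pow_succ']
          exact Nat.pow_le_pow_right (by norm_num) (by omega)
        omega

/-! ### Evaluating prefixes -/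

theorem evalQ_of_strategy (M : (ℕ → Bool) → Prop) (P : List (Quant × ℕ)) :
    ∀ (g : ℕ → Bool) (S : (ℕ → Bool) → ℕ → Bool), (P.map Prod.snd).Nodup →
    (∀ τ v, v ∉ P.map Prod.snd → S τ v = g v) →
    (∀ τ y, (Quant.all, y) ∈ P → S τ y = τ y) →
    (∀ P1 x P2, P = P1 ++ (Quant.ex, x) :: P2 → ∀ τ τ' : ℕ → Bool,
      (∀ y, (Quant.all, y) ∈ P1 → τ y = τ' y) → S τ x = S τ' x) →
    (∀ τ, M (S τ)) → evalQ P M g := by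
  induction P with
  | nil =>
    intro g S _ h1 _ _ h4
    have : S g = g := funext fun v => h1 g v (by simp)
    have h := h4 g
    rw [this] at h; exact h
  | cons a P ih =>
    obtain ⟨q, x⟩ := a
    intro g S hnd h1 h2 h3 h4
    simp only [List.map_cons, List.nodup_cons] at hnd
    cases q with
    | ex =>
      refine ⟨S g x, ih _ S hnd.2 ?_ ?_ ?_ h4⟩
      · intro τ v hv
        by_cases hvx : v = x
        · subst hvx
          rw [Function.update_self]
          exact h3 [] v P rfl τ g (by simp)
        · rw [Function.update_of_ne hvx]
          exact h1 τ v (by simp only [List.map_cons, List.mem_cons]; tauto)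
      · intro τ y hy; exact h2 τ y (List.mem_cons_of_mem _ hy)
      · intro P1 z P2 hP τ τ' hτ
        refine h3 ((Quant.ex, x) :: P1) z P2 (by rw [hP]; rfl) τ τ' fun y hy => hτ y ?_
        simpa using hy
    | all =>
      intro b
      refine ih _ (fun τ => S (Function.update τ x b)) hnd.2 ?_ ?_ ?_ (fun τ => h4 _)
      · intro τ v hv
        by_cases hvx : v = x
        · subst hvx
          rw [h2 _ _ (by simp)]; simp
        · rw [Function.update_of_ne hvx]
          exact h1 _ v (by simp only [List.map_cons, List.mem_cons]; tauto)
      · intro τ y hy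
        have hyx : y ≠ x := by
          rintro rfl
          exact hnd.1 (List.mem_map.2 ⟨_, hy, rfl⟩)
        rw [h2 _ y (List.mem_cons_of_mem _ hy), Function.update_of_ne hyx]
      · intro P1 z P2 hP τ τ' hτ
        refine h3 ((Quant.all, x) :: P1) z P2 (by rw [hP]; rfl) _ _ fun y hy => ?_
        by_cases hyx : y = x
        · subst hyx; simp
        · rw [Function.update_of_ne hyx, Function.update_of_ne hyx]
          refine hτ y ?_
          simpa [hyx] using hy

open Classical in
theorem evalQ_win (M : (ℕ → Bool) → Prop) (P : List (Quant × ℕ)) (hnd : (P.map Prod.snd).Nodup)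
    (E : (ℕ → Bool) → ℕ → Bool)
    (hE : ∀ P1 x P2, P = P1 ++ (Quant.ex, x) :: P2 → ∀ τ τ' : ℕ → Bool,
      (∀ y, (Quant.all, y) ∈ P1 → τ y = τ' y) → E τ x = E τ' x)
    (hM : ∀ τ h, (∀ q v, (q, v) ∈ P → h v = if (Quant.all, v) ∈ P then τ v else E τ v) → M h)
    (g : ℕ → Bool) : evalQ P M g := by
  refine evalQ_of_strategy M P g
    (fun τ v => if v ∈ P.map Prod.snd then (if (Quant.all, v) ∈ P then τ v else E τ v) else g v)
    hnd ?_ ?_ ?_ ?_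
  · intro τ v hv; simp only [if_neg hv]
  · intro τ y hy
    simp only [if_pos hy, if_pos (List.mem_map.2 ⟨_, hy, rfl⟩ : y ∈ P.map Prod.snd)]
  · intro P1 x P2 hP τ τ' hτ
    have hxall : (Quant.all, x) ∉ P := by
      intro hx
      have hinj := List.inj_on_of_nodup_map hnd hx
        (show (Quant.ex, x) ∈ P by rw [hP]; simp) rfl
      simp at hinj
    simp only [if_neg hxall]
    rw [hE P1 x P2 hP τ τ' hτ]
  · intro τ
    refine hM τ _ fun q v hv => ?_
    simp only [if_pos (List.mem_map.2 ⟨_, hv, rfl⟩ : v ∈ P.map Prod.snd)]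

theorem blocks (d : ℕ) : ∀ (q : Quant) (qs : List Quant), isAltFrom q d qs →
    ∃ blk : ℕ → ℕ, Monotone blk ∧ ∀ (p : ℕ) (r : Quant), qs[p]? = some r →
      blk p < d ∧ (r = q ↔ Even (blk p)) := by
  induction d with
  | zero =>
    intro q qs h
    simp only [isAltFrom] at h
    subst h
    exact ⟨fun _ => 0, monotone_const, by simp⟩
  | succ d ih =>
    intro q qs h
    obtain ⟨k, rest, rfl, hr⟩ := h
    obtain ⟨blk, hm, hb⟩ := ih _ _ hr
    refine ⟨fun p => if p < k then 0 else blk (p - k) + 1, ?_, ?_⟩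
    · intro a b hab
      simp only
      split <;> split
      · exact le_rfl
      · omega
      · omega
      · have := hm (show a - k ≤ b - k by omega); omega
    · intro p r hp
      by_cases hpk : p < k
      · rw [List.getElem?_append_left (by simpa using hpk)] at hp
        simp [hpk] at hp
        simp [hpk, hp]
      · rw [List.getElem?_append_right (by simpa using hpk)] at hp
        simp only [List.length_replicate] at hp
        obtain ⟨h1, h2⟩ := hb _ _ hp
        simp only [if_neg hpk]
        refine ⟨by omega, ?_⟩
        rw [Nat.even_add_one, ← h2]
        cases r <;> cases q <;> simp [Quant.neg]

theorem funny_matrix {n m : ℕ} {X X' Y} (hF : Funny m X X' Y) (hmn : m ≤ n) (h : ℕ → Bool)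
    (hX : ∀ i j k, i ≤ n → h (xV i j k) = X i j k)
    (hX' : ∀ i j k, 1 ≤ i → i ≤ n → h (xV' i j k) = X' i j k) (hY : h (yV m) = Y m) :
    (sepQBC n).matrix h := by
  obtain ⟨h0, hlow, hm, hmid, hhigh⟩ := hF
  rintro C (⟨j, k, rfl⟩ | ⟨j, rfl⟩ | ⟨i, hi1, hin, j, k, l, rfl⟩ | ⟨i, hi1, hin, j, k, rfl⟩) ht
  · have := ht (xV 0 j k) true (by simp [clB1])
    rw [hX _ _ _ (by omega), h0] at this; cases this
  · have hz : ∀ k, X n j k = false := by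
      intro k
      have := ht (xV n j k) false (by cases k <;> simp [clB2])
      rwa [hX _ _ _ le_rfl] at this
    have hex : ∃ k, X n j k = true := by
      rcases hmn.lt_or_eq with h | rfl
      · exact (hhigh n h).2 j
      · exact hmid.2.2 j
    obtain ⟨k, hk⟩ := hex
    rw [hz k] at hk; cases hk
  · have h1 : X' i false k = true := by
      have := ht (xV' i false k) true (by simp [clH])
      rwa [hX' _ _ _ hi1 hin] at this
    have h2 : X' i true l = true := by
      have := ht (xV' i true l) true (by simp [clH])
      rwa [hX' _ _ _ hi1 hin] at this
    have h3 : ∀ k, X (i - 1) j k = false := by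
      intro k
      have := ht (xV (i - 1) j k) false (by cases k <;> simp [clH, xV_ne_xV'])
      rwa [hX _ _ _ (by omega)] at this
    by_cases him : i ≤ m
    · have hz : ∃ j, ∀ k, X' i j k = false := by
        rcases him.lt_or_eq with h | rfl
        · exact (hlow i hi1 h).2
        · exact hmid.1
      obtain ⟨j', hj'⟩ := hz
      cases j'
      · rw [hj'] at h1; cases h1
      · rw [hj'] at h2; cases h2
    · have hex : ∃ k, X (i - 1) j k = true := by
        rcases (show m ≤ i - 1 by omega).lt_or_eq with h | h
        · exact (hhigh _ h).2 j
        · rw [← h]; exact hmid.2.2 j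
      obtain ⟨k', hk'⟩ := hex
      rw [h3] at hk'; cases hk'
  · have h1 : X i j k = true := by
      have := ht (xV i j k) true (by simp [clT])
      rwa [hX _ _ _ hin] at this
    have h2 : X' i j k = false := by
      have := ht (xV' i j k) false (by simp [clT, xV_ne_xV'.symm, xV'_ne_yV])
      rwa [hX' _ _ _ hi1 hin] at this
    have h3 : h (yV i) = j := ht (yV i) j (by simp [clT, xV_ne_yV.symm])
    rcases lt_trichotomy i m with him | rfl | him
    · rw [(hlow i hi1 him).1, h2] at h1; cases h1
    · rw [hY] at h3
      subst h3
      have := hmid.2.1 k h1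
      rw [h2] at this; cases this
    · rw [(hhigh i him).1, h2] at h1; cases h1

/-- Assemble an assignment from level functions. -/
def mkA (X X' : ℕ → Bool → Bool → Bool) (Y : ℕ → Bool) (v : ℕ) : Bool :=
  if v % 9 = 8 then Y (v / 9)
  else if v % 9 < 4 then X (v / 9) (decide (2 ≤ v % 9)) (decide (v % 9 % 2 = 1))
  else X' (v / 9) (decide (6 ≤ v % 9)) (decide (v % 9 % 2 = 1))

theorem mk_xV (X X' Y i j k) : mkA X X' Y (xV i j k) = X i j k := by
  have h : xV i j k % 9 = 2 * cond j 1 0 + cond k 1 0 ∧ xV i j k / 9 = i := by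
    cases j <;> cases k <;> simp [xV] <;> omega
  unfold mkA
  rw [h.1, h.2]
  cases j <;> cases k <;> simp

theorem mk_xV' (X X' Y i j k) : mkA X X' Y (xV' i j k) = X' i j k := by
  have h : xV' i j k % 9 = 4 + 2 * cond j 1 0 + cond k 1 0 ∧ xV' i j k / 9 = i := by
    cases j <;> cases k <;> simp [xV'] <;> omega
  unfold mkA
  rw [h.1, h.2]
  cases j <;> cases k <;> simp

theorem mk_yV (X X' Y i) : mkA X X' Y (yV i) = Y i := by
  have h : yV i % 9 = 8 ∧ yV i / 9 = i := by
    simp [yV]; omega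
  unfold mkA
  rw [h.1, h.2]; simp

theorem mem_inst (n : ℕ) (C : PA) (q : Quant) (v : ℕ) :
    (q, v) ∈ instPrefix (sepPrefix n) C ↔ (5 ≤ posV v ∧ posV v < 9 * n + 9) ∧ C v = none ∧
      (((∃ u, C u ≠ none ∧ strictPrec (sepPrefix n) v u) ∧ q = Quant.ex) ∨
       ((¬ ∃ u, C u ≠ none ∧ strictPrec (sepPrefix n) v u) ∧ q = quantV v)) := by
  unfold instPrefix
  simp only [List.mem_map, List.mem_filter, Prod.mk.injEq, Option.isNone_iff_eq_none]
  constructor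
  · rintro ⟨⟨q', w⟩, ⟨hw, hC⟩, hq, rfl⟩
    rw [mem_sep] at hw
    refine ⟨hw.2, hC, ?_⟩
    split at hq
    · exact Or.inl ⟨by assumption, hq.symm⟩
    · exact Or.inr ⟨by assumption, by rw [← hq, ← hw.1]⟩
  · rintro ⟨hv, hC, h⟩
    refine ⟨(quantV v, v), ⟨(mem_sep n _ v).2 ⟨rfl, hv⟩, hC⟩, ?_, rfl⟩
    rcases h with ⟨h1, h2⟩ | ⟨h1, h2⟩
    · rw [if_pos h1, h2]
    · rw [if_neg h1, h2]

theorem inst_pairwise (n : ℕ) (C : PA) :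
    (instPrefix (sepPrefix n) C).Pairwise fun a b => posV a.2 < posV b.2 := by
  unfold instPrefix
  rw [List.pairwise_map]
  exact (sep_pairwise n).filter _

theorem inst_nodup (n : ℕ) (C : PA) : ((instPrefix (sepPrefix n) C).map Prod.snd).Nodup := by
  rw [List.Nodup, List.pairwise_map]
  exact (inst_pairwise n C).imp fun h e => by rw [e] at h; omega

theorem inst_preceq {n : ℕ} {C : PA} {q q' : Quant} {u v : ℕ}
    (hu : (q, u) ∈ instPrefix (sepPrefix n) C) (hv : (q', v) ∈ instPrefix (sepPrefix n) C)
    (h : posV u < posV v) : preceq (instPrefix (sepPrefix n) C) u v := by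
  obtain ⟨a, ha, ea⟩ := List.getElem_of_mem hu
  obtain ⟨b, hb, eb⟩ := List.getElem_of_mem hv
  refine ⟨a, b, ?_, ?_, Or.inl ?_⟩
  · rw [List.getElem?_eq_getElem ha, ea]; rfl
  · rw [List.getElem?_eq_getElem hb, eb]; rfl
  · by_contra hba
    have := List.pairwise_iff_getElem.1 (inst_pairwise n C) b a hb ha (by omega)
    rw [ea, eb] at this
    simp only at this
    omega

theorem pos_unique {P : List (Quant × ℕ)} (hnd : (P.map Prod.snd).Nodup) {a b v : ℕ}
    (ha : (P[a]?).map Prod.snd = some v) (hb : (P[b]?).map Prod.snd = some v) : a = b := by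
  rw [← List.getElem?_map] at ha hb
  obtain ⟨ha', ea⟩ := List.getElem?_eq_some_iff.1 ha
  obtain ⟨hb', eb⟩ := List.getElem?_eq_some_iff.1 hb
  exact (hnd.getElem_inj_iff).1 (ea.trans eb.symm)

theorem exists_seen {n d m : ℕ} {C : PA} {P : List (Quant × ℕ)}
    (hrel : IsRelaxationPfx (instPrefix (sepPrefix n) C) P) (hpi : isPiPrefix d P)
    (hle : ExLe C m) (hm : m < n - (d + 1) / 2) :
    ∃ i, m < i ∧ i ≤ n ∧ ((Quant.all, yV i) ∈ P → ∀ j, ∀ P1 P2,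
      P = P1 ++ (Quant.ex, xV' i j false) :: P2 → (Quant.all, yV i) ∈ P1) := by
  by_contra hcon
  push Not at hcon
  obtain ⟨blk, hmono, hblk⟩ := blocks d _ _ hpi
  have hnd : (P.map Prod.snd).Nodup := (hrel.1.map Prod.snd).nodup_iff.1 (inst_nodup n C)
  have hb : ∀ p q v, P[p]? = some (q, v) → blk p < d ∧ (q = Quant.all ↔ Even (blk p)) := by
    intro p q v h
    exact hblk p q (by rw [List.getElem?_map, h]; rfl)
  -- the primed variable comes before the universal one
  have hxy : ∀ i, m < i → i ≤ n → ∃ (j : Bool) (a b : ℕ), a < b ∧ P[a]? = some (Quant.ex, xV' i j false) ∧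
      P[b]? = some (Quant.all, yV i) := by
    intro i h1 h2
    obtain ⟨hy, j, P1, P2, hP, hn⟩ := hcon i h1 h2
    rw [hP] at hy
    have hy2 : (Quant.all, yV i) ∈ P2 := by
      simp only [List.mem_append, List.mem_cons] at hy
      rcases hy with h | h | h
      · exact absurd h hn
      · simp at h
      · exact h
    obtain ⟨c, hc, ec⟩ := List.getElem_of_mem hy2
    refine ⟨j, P1.length, P1.length + (c + 1), by omega, ?_, ?_⟩
    · rw [hP]; simp
    · rw [hP, List.getElem?_append_right (by omega)]
      simp [List.getElem?_eq_getElem hc, ec]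
  have chain : ∀ t, 1 ≤ t → m + t ≤ n → ∀ p, P[p]? = some (Quant.all, yV (m + t)) →
      2 * t ≤ blk p + 1 := by
    intro t ht
    induction t, ht using Nat.le_induction with
    | base =>
      intro h p hp
      obtain ⟨j, a, b, hab, ha, hb'⟩ := hxy (m + 1) (by omega) h
      have : b = p := pos_unique hnd (by rw [hb']; rfl) (by rw [hp]; rfl)
      subst this
      have e1 := (hb _ _ _ ha).2
      have e2 := (hb _ _ _ hp).2
      have e3 := hmono hab.le
      simp at e1 e2
      rcases e1 with ⟨c, hc⟩
      omega
    | succ t ht ih =>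
      intro h p hp
      obtain ⟨j, a, b, hab, ha, hb'⟩ := hxy (m + (t + 1)) (by omega) h
      have : b = p := pos_unique hnd (by rw [hb']; rfl) (by rw [hp]; rfl)
      subst this
      obtain ⟨_, _, b0, _, _, hb0⟩ := hxy (m + t) (by omega) (by omega)
      have hi := ih (by omega) b0 hb0
      have hyQ : (Quant.all, yV (m + t)) ∈ instPrefix (sepPrefix n) C :=
        hrel.1.mem_iff.2 (List.mem_of_getElem? hb0)
      have hxQ : (Quant.ex, xV' (m + (t + 1)) j false) ∈ instPrefix (sepPrefix n) C :=
        hrel.1.mem_iff.2 (List.mem_of_getElem? ha)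
      have hpr : preceq P (yV (m + t)) (xV' (m + (t + 1)) j false) := by
        refine hrel.2 _ ?_ _ ?_ (inst_preceq hyQ hxQ ?_)
        · exact List.mem_map.2 ⟨_, List.mem_filter.2 ⟨hyQ, by simp⟩, rfl⟩
        · exact List.mem_map.2 ⟨_, List.mem_filter.2 ⟨hxQ, by simp⟩, rfl⟩
        · have := pos_xV' (m + (t + 1)) j false
          rw [pos_yV]; omega
      have hle' : b0 ≤ a := by
        obtain ⟨c, e, hc, he, hce⟩ := hpr
        have e1 : c = b0 := pos_unique hnd hc (by rw [hb0]; rfl)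
        have e2 : e = a := pos_unique hnd he (by rw [ha]; rfl)
        subst e1 e2
        rcases hce with h | ⟨h1, h2⟩
        · exact h
        · have := h2 c h1.le le_rfl
          rw [hb0, ha] at this; simp at this
      have e1 := (hb _ _ _ ha).2
      have e2 := (hb _ _ _ hp).2
      have e0 := (hb _ _ _ hb0).2
      have e3 := hmono hab.le
      have e4 := hmono hle'
      simp only [true_iff, reduceCtorEq, false_iff, Nat.not_even_iff, Nat.even_iff] at e0 e1 e2
      omega
  obtain ⟨_, _, b, _, _, hb'⟩ := hxy n (by omega) le_rfl
  have := chain (n - m) (by omega) (by omega) b (by rw [hb']; congr 3; omega)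
  have := (hb _ _ _ hb').1
  omega

theorem no_all_xV {n : ℕ} {C : PA} {v : ℕ} (hv : quantV v = Quant.ex) :
    (Quant.all, v) ∉ instPrefix (sepPrefix n) C := by
  rw [mem_inst]
  rintro ⟨_, _, ⟨_, h⟩ | ⟨_, h⟩⟩
  · cases h
  · rw [hv] at h; cases h

theorem in_inst {n : ℕ} {C : PA} {v : ℕ} (h1 : 5 ≤ posV v) (h2 : posV v < 9 * n + 9)
    (hC : C v = none) : ∃ q, (q, v) ∈ instPrefix (sepPrefix n) C := by
  by_cases h : ∃ u, C u ≠ none ∧ strictPrec (sepPrefix n) v u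
  · exact ⟨Quant.ex, (mem_inst n C _ v).2 ⟨⟨h1, h2⟩, hC, Or.inl ⟨h, rfl⟩⟩⟩
  · exact ⟨quantV v, (mem_inst n C _ v).2 ⟨⟨h1, h2⟩, hC, Or.inr ⟨h, rfl⟩⟩⟩

/-- Winning in any relaxation from a family of funny assignments. -/
theorem win_of_funny {n i : ℕ} {C : PA} {P : List (Quant × ℕ)}
    (hperm : (instPrefix (sepPrefix n) C).Perm P) (hin : i ≤ n)
    (X : ℕ → Bool → Bool → Bool) (X' : (ℕ → Bool) → ℕ → Bool → Bool → Bool)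
    (Y : (ℕ → Bool) → ℕ → Bool) (y0 : ℕ → Bool)
    (hext : ∀ τ, ExtC C X (X' τ) y0)
    (hF : ∀ τ, Funny i X (X' τ) (Y τ))
    (hY : ∀ τ, ((Quant.all, yV i) ∈ P → Y τ i = τ (yV i)) ∧ ((Quant.all, yV i) ∉ P → Y τ i = y0 i))
    (hdep : ∀ P1 l j k P2, P = P1 ++ (Quant.ex, xV' l j k) :: P2 → ∀ τ τ' : ℕ → Bool,
      (∀ y, (Quant.all, y) ∈ P1 → τ y = τ' y) → X' τ l j k = X' τ' l j k)
    (g : ℕ → Bool) : evalQ P (fun g => (sepQBC n).matrix (override C g)) g := by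
  have hnd : (P.map Prod.snd).Nodup := (hperm.map Prod.snd).nodup_iff.1 (inst_nodup n C)
  refine evalQ_win _ P hnd (fun τ => mkA X (X' τ) y0) ?_ ?_ g
  · intro P1 x P2 hP τ τ' hτ
    rcases var_cases x with ⟨l, j, k, rfl⟩ | ⟨l, j, k, rfl⟩ | ⟨l, rfl⟩
    · simp only [mk_xV]
    · simp only [mk_xV']; exact hdep P1 l j k P2 hP τ τ' hτ
    · simp only [mk_yV]
  · intro τ h hh
    have key : ∀ v, 5 ≤ posV v → posV v < 9 * n + 9 → C v = none →
        ((Quant.all, v) ∈ P → h v = τ v) ∧ ((Quant.all, v) ∉ P → h v = mkA X (X' τ) y0 v) := by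
      intro v h1 h2 hC
      obtain ⟨q, hq⟩ := in_inst h1 h2 hC
      have := hh q v (hperm.mem_iff.1 hq)
      constructor <;> intro h' <;> simpa [h'] using this
    have nall : ∀ v, quantV v = Quant.ex → (Quant.all, v) ∉ P := fun v hv hP =>
      no_all_xV hv (hperm.mem_iff.2 hP)
    have hi := (hF τ).2.2.1
    refine funny_matrix (hF τ) hin _ ?_ ?_ ?_
    · intro l j k hl
      unfold override
      cases e : C (xV l j k) with
      | some b => exact ((hext τ).1 _ _ _ _ e).symm
      | none =>
        have hp := pos_xV l j k
        have := (key _ (by omega) (by omega) e).2 (nall _ (quant_xV l j k))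
        rw [mk_xV] at this; exact this
    · intro l j k hl1 hl
      unfold override
      cases e : C (xV' l j k) with
      | some b => exact ((hext τ).2.1 _ _ _ _ e).symm
      | none =>
        have hp := pos_xV' l j k
        have := (key _ (by omega) (by omega) e).2 (nall _ (quant_xV' l j k))
        rw [mk_xV'] at this; exact this
    · unfold override
      cases e : C (yV i) with
      | some b =>
        have hn : (Quant.all, yV i) ∉ P := by
          intro hP
          have := ((mem_inst n C _ _).1 (hperm.mem_iff.2 hP)).2.1
          rw [e] at this; cases this
        rw [(hY τ).2 hn, (hext τ).2.2 _ _ e]; rfl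
      | none =>
        have hp := pos_yV i
        have hk := key (yV i) (by omega) (by omega) e
        by_cases hP : (Quant.all, yV i) ∈ P
        · rw [(hY τ).1 hP]; exact hk.1 hP
        · rw [(hY τ).2 hP]
          have := hk.2 hP
          rw [mk_yV] at this; exact this

open Classical in
theorem win_N {n d m : ℕ} {C : PA} {P : List (Quant × ℕ)}
    (hrel : IsRelaxationPfx (instPrefix (sepPrefix n) C) P) (hpi : isPiPrefix d P)
    (hm : m < n - (d + 1) / 2) {X X' Y} (hN : NState C m X X' Y) (g : ℕ → Bool) :
    evalQ P (fun g => (sepQBC n).matrix (override C g)) g := by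
  obtain ⟨h1, h2, h3, h4⟩ := hN
  obtain ⟨i, him, hin, hseen⟩ := exists_seen hrel hpi h4 hm
  refine win_of_funny hrel.1 hin
    (fun l j k => if l ≤ m then X l j k else if l < i then false else if l = i then !k else true)
    (fun τ l j k => if l ≤ m then X' l j k else if l < i then false
      else if l = i then (!k && ((if (Quant.all, yV i) ∈ P then τ (yV i) else Y i) == j)) else true)
    (fun τ _ => if (Quant.all, yV i) ∈ P then τ (yV i) else Y i) Y ?_ ?_ ?_ ?_ g
  · intro τ
    refine ⟨?_, ?_, h1.2.2⟩
    · intro l j k b e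
      by_cases hl : l ≤ m
      · simp only [if_pos hl]; exact h1.1 _ _ _ _ e
      · rw [(h4 l (by omega) j k).1] at e; cases e
    · intro l j k b e
      by_cases hl : l ≤ m
      · simp only [if_pos hl]; exact h1.2.1 _ _ _ _ e
      · rw [(h4 l (by omega) j k).2] at e; cases e
  · intro τ
    generalize (if (Quant.all, yV i) ∈ P then τ (yV i) else Y i) = w
    refine ⟨?_, ?_, by omega, ?_, ?_⟩
    · intro j k; simp only [Nat.zero_le, if_true]; exact h2 j k
    · intro l hl1 hl2
      by_cases hl : l ≤ m
      · have := h3 l hl1 hl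
        unfold LowL
        simp only [if_pos hl]; exact this
      · unfold LowL
        simp [if_neg hl, if_pos hl2]
    · unfold MidL
      simp only [if_neg (show ¬ (i ≤ m) by omega), lt_irrefl, if_false, if_true]
      exact ⟨⟨!w, by simp⟩, by simp, fun j => ⟨false, by simp⟩⟩
    · intro l hl
      unfold HighL
      simp [if_neg (show ¬ (l ≤ m) by omega), if_neg (show ¬ (l < i) by omega),
        if_neg (show ¬ (l = i) by omega)]
  · intro τ
    exact ⟨fun h => by simp [h], fun h => by simp [h]⟩
  · intro P1 l j k P2 hP τ τ' hτ
    by_cases hl : l = i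
    · subst hl
      by_cases hall : (Quant.all, yV l) ∈ P
      · cases k with
        | true => simp
        | false =>
          have := hτ _ (hseen hall j P1 P2 hP)
          simp only [this]
      · simp only [if_neg hall]
    · simp only [if_neg hl]

theorem leaf_score {n d : ℕ} (C : PA) (hC : C ∈ Hset (sepQBC n) d) (s : ℕ) (hg : Good C s) :
    n - (d + 1) / 2 ≤ s := by
  by_contra hs
  obtain ⟨hvars, ⟨P, M⟩, ⟨hrel, hM⟩, hpi, hfalse⟩ := hC
  simp only [QBC.inst] at hrel hM hpi hvars
  subst hM
  apply hfalse
  intro g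
  change evalQ P (fun g => (sepQBC n).matrix (override C g)) g
  change IsRelaxationPfx (instPrefix (sepPrefix n) C) P at hrel
  obtain ⟨X, X', Y, m, hm, hN | ⟨h1, h2⟩⟩ := hg
  · exact win_N hrel hpi (by omega) hN g
  · by_cases hall : (Quant.all, yV m) ∈ P
    · have hQ := (mem_inst n C _ _).1 (hrel.1.mem_iff.2 hall)
      have hnot : ¬ ∃ u, C u ≠ none ∧ strictPrec (sepPrefix n) (yV m) u := by
        rcases hQ.2.2 with ⟨_, h⟩ | ⟨h, _⟩
        · cases h
        · exact h
      have hpos : ∀ u, C u ≠ none → posV u ≤ 9 * m + 4 := by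
        intro u hu
        by_contra hgt
        have hv := (mem_sepvars n u).1 (hvars u hu)
        refine hnot ⟨u, hu, preceq_of_pos hQ.1.1 hv.2 (by rw [pos_yV]; omega), fun h => ?_⟩
        have := preceq_yV h
        rw [pos_yV] at this; omega
      have hx : ∀ l, m ≤ l → ∀ j k, C (xV l j k) = none := by
        intro l hl j k
        by_contra hne
        have := hpos _ hne
        have := pos_xV l j k
        omega
      have hx' : ∀ l, m < l → ∀ j k, C (xV' l j k) = none := by
        intro l hl j k
        by_contra hne
        have := hpos _ hne
        have := pos_xV' l j k
        omega
      obtain ⟨Z, hZ⟩ := trunc h2.2.2.1 h1 h2.1 h2.2.1 h2.2.2.2.1.1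
        (fun l hl j k => ⟨hx l hl.le j k, hx' l hl j k⟩) (hx m le_rfl)
      exact win_N hrel hpi (by omega) hZ g
    · exact win_of_funny hrel.1 (by omega) X (fun _ => X') (fun _ => Y) Y (fun _ => h1) (fun _ => h2)
        (fun τ => ⟨fun h => absurd h hall, fun _ => rfl⟩) (fun _ _ _ _ _ _ _ _ _ => rfl) g

/-- Theorem 6.6: for `2 ≤ d ≤ 2n`, every tree-like
QU-resolution falsity proof of `Φₙ` from `H(Φₙ, Π_d)` has at least
`2^{n − ⌈d/2⌉}` leaves, and hence size at least `2^{n − ⌈d/2⌉}`. -/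
theorem sep_treelike_lower_bound (d n : ℕ) (hd : 2 ≤ d) (hdn : d ≤ 2 * n)
    (L : List QUStep) (hL : IsFalsityProof (sepQBC n) (Hset (sepQBC n) d) L)
    (htree : TreeLike L) :
    2 ^ (n - (d + 1) / 2) ≤ {i | isSink L i}.ncard ∧
    2 ^ (n - (d + 1) / 2) ≤ L.length := by
  obtain ⟨hv, hlast⟩ := hL
  have h1 : stepClause? L (L.length - 1) = some emptyPA := by
    unfold stepClause?
    rw [← List.getLast?_eq_getElem?]; exact hlast
  have h2 := leaf_count (n := n) (p := n - (d + 1) / 2) leaf_score hv htree _ _ 0 h1 good_empty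
  rw [Nat.sub_zero] at h2
  have h3 : (leavesOf L (L.length - 1)).ncard ≤ {i | isSink L i}.ncard :=
    Set.ncard_le_ncard (fun _ h => h.1) (sink_finite L)
  have h4 : {i | isSink L i}.ncard ≤ L.length := by
    have : {i | isSink L i} ⊆ (Finset.range L.length : Set ℕ) := fun i h => by simpa using h.1
    have h5 := Set.ncard_le_ncard this (Finset.finite_toSet _)
    rwa [Set.ncard_coe_finset, Finset.card_range] at h5
  exact ⟨h2.trans h3, h2.trans (h3.trans h4)⟩
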